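/- Let μ be a probability measure on a countable group G. Suppose there is N ≥ 1 such that the support of μ^{*N} contains a finite symmetric subset generating a subgroup H whose growth function satisfies v_H(n) ≽ n^d for some d ≥ 1, i.e. there exist a finite symmetric generating set S of H and c > 0 with |(S ∪ {e})^n| ≥ c n^d for all n ≥ 1. Let {μ_k}_{k≥1} be probability measures on G with μ_k(g) → μ(g) for every g ∈ G. Then there exist C > 0 and K ≥ 1 such that for all n ≥ 1: sup_{k≥K} sup_{x,y∈G} p_{μ_k}^{(n)}(x,y) ≤ C n^{-d/2} and sup_{x,y∈G} p_μ^{(n)}(x,y) ≤ C n^{-d/2}. -/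

import Mathlib

open Filter

namespace RW


variable {G : Type*} [Group G]

/-- `μ` is a probability mass function on the countable group `G`. -/
def IsProb (μ : G → ℝ) : Prop := (∀ g, 0 ≤ μ g) ∧ HasSum μ 1

/-- Convolution of two measures: `(μ * ν)(g) = ∑_h μ(g h⁻¹) ν(h)`. -/
noncomputable def conv (μ ν : G → ℝ) : G → ℝ := fun g => ∑' h : G, μ (g * h⁻¹) * ν h

open Classical in
/-- `n`-fold convolution power of `μ`; `convPow μ 0` is the Dirac mass at the identity. -/
noncomputable def convPow (μ : G → ℝ) : ℕ → G → ℝ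
  | 0 => fun g => if g = 1 then (1 : ℝ) else 0
  | n + 1 => conv (convPow μ n) μ

/-- Shannon entropy `H(μ) = -∑_g μ(g) log μ(g)`. -/
noncomputable def entropy (μ : G → ℝ) : ℝ := ∑' g : G, Real.negMulLog (μ g)

/-- `H(μ) < ∞`. -/
def FiniteEntropy (μ : G → ℝ) : Prop := Summable fun g : G => Real.negMulLog (μ g)

/-- Asymptotic entropy `h(μ) = lim_n H(μ^{*n})/n` (the limit exists by subadditivity,
so it coincides with the `limsup`). -/
noncomputable def asympEntropy (μ : G → ℝ) : ℝ :=
  Filter.limsup (fun n : ℕ => entropy (convPow μ n) / (n : ℝ)) Filter.atTop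

/-- Position of the random walk at time `m`, given the sequence of increments `gs`
(0-indexed: the `i`-th increment is `g_{i+1} = gs i`), so `walk gs m = g_1 ⋯ g_m`. -/
def walk (gs : ℕ → G) (m : ℕ) : G := ((List.range m).map gs).prod

/-- Extend a finite tuple of increments to an infinite sequence, padding by `1`. -/
noncomputable def pad {n : ℕ} (gs : Fin n → G) : ℕ → G :=
  fun i => if h : i < n then gs ⟨i, h⟩ else 1

/-- Probability, for the random walk with step distribution `μ`, of an event `E` about the
increment sequence that only depends on the first `n` increments. -/
noncomputable def cylProb (μ : G → ℝ) (n : ℕ) (E : Set (ℕ → G)) : ℝ :=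
  ∑' gs : Fin n → G,
    Set.indicator {v : Fin n → G | pad v ∈ E} (fun v => ∏ i, μ (v i)) gs

/-- Escape probability `p_esc(μ) = P(w_m ≠ e for all m ≥ 1)`: the (decreasing) limit,
i.e. the infimum, of the probabilities of not returning to the identity up to time `n`. -/
noncomputable def escapeProb (μ : G → ℝ) : ℝ :=
  ⨅ n : ℕ, cylProb μ n {gs | ∀ m, 1 ≤ m → m ≤ n → walk gs m ≠ 1}

/-- The `μ`-random walk is transient. -/
def Transient (μ : G → ℝ) : Prop := 0 < escapeProb μ

/-- The subsemigroup generated by the support of `μ`, as a set. -/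
def suppSemigroup (μ : G → ℝ) : Set G :=
  (Subsemigroup.closure (Function.support μ) : Subsemigroup G)

/-- `μ` is non-degenerate: the semigroup generated by its support is all of `G`. -/
def NonDegenerate (μ : G → ℝ) : Prop := ∀ g : G, g ∈ suppSemigroup μ

/-- The semigroup generated by the support of `μ` is symmetric (closed under inversion). -/
def SymmetricSemigroup (μ : G → ℝ) : Prop := ∀ g ∈ suppSemigroup μ, g⁻¹ ∈ suppSemigroup μ

/-- Law of a random variable `X` of the increment sequence that only depends on the
first `n` increments. -/
noncomputable def law (μ : G → ℝ) (n : ℕ) {D : Type*} (X : (ℕ → G) → D) : D → ℝ :=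
  fun d => cylProb μ n {gs | X gs = d}

/-- Shannon entropy `H_μ(X)` of a random variable `X` of the increment sequence that only
depends on the first `n` increments. -/
noncomputable def entropyRV (μ : G → ℝ) (n : ℕ) {D : Type*} (X : (ℕ → G) → D) : ℝ :=
  ∑' d : D, Real.negMulLog (law μ n X d)

/-- Conditional entropy `H_μ(X | Y) = H_μ(X, Y) - H_μ(Y)`. -/
noncomputable def condEntropyRV (μ : G → ℝ) (n : ℕ) {D E : Type*}
    (X : (ℕ → G) → D) (Y : (ℕ → G) → E) : ℝ :=
  entropyRV μ n (fun gs => (X gs, Y gs)) - entropyRV μ n Y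

/-- Expectation `E_μ(X)` of a real random variable `X` of the increment sequence that only
depends on the first `n` increments. -/
noncomputable def expect (μ : G → ℝ) (n : ℕ) (X : (ℕ → G) → ℝ) : ℝ :=
  ∑' gs : Fin n → G, (∏ i, μ (gs i)) * X (pad gs)

/-- The `t₀`-coarse trajectory at instant `n`: `(w_{t₀}, w_{2t₀}, …, w_{⌊n/t₀⌋t₀})`. -/
def coarseTraj (t₀ n : ℕ) (gs : ℕ → G) : Fin (n / t₀) → G :=
  fun j => walk gs ((j.1 + 1) * t₀)

/-- The `n`-ball `(T ∪ {1})^n`: products of `n` elements of `T ∪ {1}`. -/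
def ballOf (T : Set G) (n : ℕ) : Set G :=
  {g | ∃ l : List G, l.length = n ∧ (∀ x ∈ l, x ∈ insert (1 : G) T) ∧ l.prod = g}

/-- The set `T` contains a finite symmetric set `S` generating a subgroup whose growth
function is at least `C n^d`. -/
def GrowthAtLeastWithin (T : Set G) (d : ℝ) : Prop :=
  ∃ S : Finset G, (S : Set G) ⊆ T ∧ (∀ s ∈ S, s⁻¹ ∈ S) ∧
    ∃ C : ℝ, 0 < C ∧ ∀ n : ℕ, 1 ≤ n →
      C * (n : ℝ) ^ d ≤ ((ballOf (S : Set G) n).ncard : ℝ)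

/-- `P_μ(∃ ℓ > n₀, w_ℓ ∈ F)`: the (increasing) limit, i.e. the supremum, over finite
horizons `m` of the probability of visiting `F` at some time in `(n₀, m]`. -/
noncomputable def returnProbAfter (μ : G → ℝ) (n₀ : ℕ) (F : Set G) : ℝ :=
  ⨆ m : ℕ, cylProb μ m {gs | ∃ ℓ, n₀ < ℓ ∧ ℓ ≤ m ∧ walk gs ℓ ∈ F}

/-- The set of `(n₀,t₀,F)`-unstable points at instant `n`. -/
def unstablePts (n₀ t₀ n : ℕ) (F : Set G) (gs : ℕ → G) : Set G :=
  {b | ∃ j, j ≤ n / t₀ - n₀ ∧ ∃ ℓ, ℓ ≤ n / t₀ ∧ j + n₀ < ℓ ∧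
    (∃ f ∈ F, walk gs (j * t₀) * f = b) ∧ (∃ f ∈ F, walk gs (ℓ * t₀) * f = b)}

/-- The set of visits to `(n₀,t₀,F)`-unstable points by time `n`. -/
def unstableVisits (n₀ t₀ n : ℕ) (F : Set G) (gs : ℕ → G) : Set ℕ :=
  {j | j ≤ n / t₀ - n₀ ∧ ∃ b ∈ unstablePts n₀ t₀ n F gs, ∃ f ∈ F, walk gs (j * t₀) * f = b}

/-- Product measure `μ^{t₀}` of a subset of `G^{t₀}`. -/
noncomputable def prodMeas (μ : G → ℝ) (t₀ : ℕ) (E : Set (Fin t₀ → G)) : ℝ :=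
  ∑' v : Fin t₀ → G, Set.indicator E (fun v => ∏ i, μ (v i)) v

open Classical in
/-- The random variable `W̃`: the tuple of the first `t₀` increments if the event `E`
occurs, and the extra symbol `⋆` (here `none`) otherwise. -/
noncomputable def obscure {t₀ : ℕ} (E : Set (Fin t₀ → G)) (gs : ℕ → G) :
    Option (Fin t₀ → G) :=
  if (fun i : Fin t₀ => gs i.1) ∈ E then some (fun i : Fin t₀ => gs i.1) else none

/-- A group `H` is ICC if it is non-trivial and every non-identity element has an
infinite conjugacy class. -/
def IsICC (H : Type*) [Group H] : Prop :=
  Nontrivial H ∧ ∀ h : H, h ≠ 1 → (Set.range fun g : H => g * h * g⁻¹).Infinite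

/-- A group is hyper-FC-central if it has no non-trivial ICC quotient. -/
def HyperFCCentral (G : Type*) [Group G] : Prop :=
  ∀ (N : Subgroup G) [N.Normal], ¬ IsICC (G ⧸ N)


section Convolution

variable {f g k : G → ℝ}

omit [Group G] in
lemma IsProb.le_one (hf : IsProb f) (x : G) : f x ≤ 1 :=
  le_hasSum hf.2 x fun y _ => hf.1 y

/-- The bijection `(x, h) ↦ (x h⁻¹, h)` of `G × G`. -/
def shearEquiv (G : Type*) [Group G] : G × G ≃ G × G where
  toFun p := (p.1 * p.2⁻¹, p.2)
  invFun p := (p.1 * p.2, p.2)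
  left_inv p := by simp
  right_inv p := by simp

lemma IsProb.hasSum_shear (hf : IsProb f) (hg : IsProb g) :
    HasSum (fun p : G × G => f (p.1 * p.2⁻¹) * g p.2) 1 := by
  have h := hf.2.mul hg.2 (hf.2.summable.mul_of_nonneg hg.2.summable hf.1 hg.1)
  rw [mul_one] at h
  exact (shearEquiv G).hasSum_iff.2 h

lemma IsProb.summable_conv (hf : IsProb f) (hg : IsProb g) (x : G) :
    Summable fun h => f (x * h⁻¹) * g h :=
  Summable.of_nonneg_of_le (fun _ => mul_nonneg (hf.1 _) (hg.1 _))
    (fun _ => mul_le_of_le_one_left (hg.1 _) (hf.le_one _)) hg.2.summable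

lemma IsProb.conv (hf : IsProb f) (hg : IsProb g) : IsProb (conv f g) :=
  ⟨fun _ => tsum_nonneg fun _ => mul_nonneg (hf.1 _) (hg.1 _),
    (hf.hasSum_shear hg).prod_fiberwise fun x => (hf.summable_conv hg x).hasSum⟩

lemma isProb_convPow_zero (f : G → ℝ) : IsProb (convPow f 0) := by
  classical
  refine ⟨fun g => ?_, ?_⟩
  · simp only [convPow]; split_ifs <;> norm_num
  · simp only [convPow]
    convert hasSum_ite_eq (1 : G) (1 : ℝ)

lemma IsProb.convPow (hf : IsProb f) (n : ℕ) : IsProb (convPow f n) := by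
  induction n with
  | zero => exact isProb_convPow_zero f
  | succ n ih => exact ih.conv hf

lemma conv_convPow_zero (f k : G → ℝ) : conv f (convPow k 0) = f := by
  funext x
  rw [RW.conv, tsum_eq_single 1]
  · simp [RW.convPow]
  · intro h hh
    simp [RW.convPow, hh]

lemma conv_assoc (hf : IsProb f) (hg : IsProb g) (hk : IsProb k) :
    conv (conv f g) k = conv f (conv g k) := by
  funext x
  have hsum : Summable (Function.uncurry fun i h : G => f (x * i⁻¹) * (g (i * h⁻¹) * k h)) :=
    Summable.of_nonneg_of_le
      (fun p => mul_nonneg (hf.1 _) (mul_nonneg (hg.1 _) (hk.1 _)))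
      (fun p => mul_le_of_le_one_left (mul_nonneg (hg.1 _) (hk.1 _)) (hf.le_one _))
      (hg.hasSum_shear hk).summable
  calc conv (conv f g) k x
      = ∑' h, ∑' i, f (x * i⁻¹) * (g (i * h⁻¹) * k h) := by
        refine tsum_congr fun h => ?_
        rw [RW.conv, ← tsum_mul_right, ← (Equiv.mulRight h⁻¹).tsum_eq]
        refine tsum_congr fun i => ?_
        simp [mul_assoc]
    _ = ∑' i, ∑' h, f (x * i⁻¹) * (g (i * h⁻¹) * k h) := hsum.tsum_comm
    _ = conv f (conv g k) x := tsum_congr fun i => tsum_mul_left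

lemma convPow_add (hf : IsProb f) (m n : ℕ) :
    convPow f (m + n) = conv (convPow f m) (convPow f n) := by
  induction n with
  | zero => rw [add_zero, conv_convPow_zero]
  | succ n ih =>
    change conv (convPow f (m + n)) f = conv (convPow f m) (conv (convPow f n) f)
    rw [ih, conv_assoc (hf.convPow m) (hf.convPow n) hf]

lemma conv_le_of_le (hf : IsProb f) (hg : IsProb g) {M : ℝ} (hM : ∀ x, f x ≤ M) (x : G) :
    conv f g x ≤ M := by
  have h := hg.2.mul_left M
  rw [mul_one] at h
  exact hasSum_le (fun y => mul_le_mul_of_nonneg_right (hM _) (hg.1 y))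
    (hf.summable_conv hg x).hasSum h

lemma eventually_le_convPow {ι : Type*} {l : Filter ι} {fk : ι → G → ℝ}
    (hf : IsProb f) (hfk : ∀ i, IsProb (fk i)) (hlim : ∀ x, Tendsto (fun i => fk i x) l (nhds (f x)))
    (n : ℕ) {x : G} (hx : convPow f n x ≠ 0) :
    ∃ ε > 0, ∀ᶠ i in l, ε ≤ convPow (fk i) n x := by
  induction n generalizing x with
  | zero =>
    exact ⟨convPow f 0 x, lt_of_le_of_ne ((hf.convPow 0).1 x) hx.symm, .of_forall fun i => le_rfl⟩
  | succ n ih =>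
    obtain ⟨h, hh⟩ : ∃ h, convPow f n (x * h⁻¹) * f h ≠ 0 := by
      by_contra! H
      exact hx (by simp [RW.convPow, RW.conv, H])
    obtain ⟨ε, hε, hev⟩ := ih (left_ne_zero_of_mul hh)
    have hpos : 0 < f h := lt_of_le_of_ne (hf.1 h) (right_ne_zero_of_mul hh).symm
    refine ⟨ε * (f h / 2), by positivity, ?_⟩
    filter_upwards [hev, (hlim h).eventually (lt_mem_nhds (half_lt_self hpos))] with i h1 h2
    calc ε * (f h / 2) ≤ convPow (fk i) n (x * h⁻¹) * fk i h :=
        mul_le_mul h1 h2.le (half_pos hpos).le (hε.le.trans h1)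
      _ ≤ convPow (fk i) (n + 1) x :=
        (((hfk i).convPow n).summable_conv (hfk i) x).le_tsum h fun j _ =>
          mul_nonneg (((hfk i).convPow n).1 _) ((hfk i).1 _)

end Convolution

section Hilbert

open scoped Pointwise

/-- Right translation `f ↦ f (· h)` as an isometry of `ℓ²(G)`. -/
noncomputable def shift (h : G) : lp (fun _ : G => ℝ) 2 →ₗᵢ[ℝ] lp (fun _ : G => ℝ) 2 where
  toFun f := ⟨fun x => f (x * h), memℓp_gen
    (((lp.memℓp f).summable (by norm_num)).comp_injective (mul_left_injective h))⟩
  map_add' f g := rfl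
  map_smul' c f := rfl
  norm_map' f := by
    have h2 : 0 < (2 : ENNReal).toReal := by norm_num
    rw [lp.norm_eq_tsum_rpow h2, lp.norm_eq_tsum_rpow h2]
    congr 1
    exact (Equiv.mulRight h).tsum_eq fun x => ‖f x‖ ^ (2 : ENNReal).toReal

lemma shift_apply (h : G) (f : lp (fun _ : G => ℝ) 2) (x : G) : shift h f x = f (x * h) := rfl

lemma shift_mul (a b : G) (f : lp (fun _ : G => ℝ) 2) : shift (a * b) f = shift a (shift b f) := by
  ext x
  simp [shift_apply, mul_assoc]

lemma shift_one (f : lp (fun _ : G => ℝ) 2) : shift 1 f = f := by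
  ext x
  simp [shift_apply]

variable {f g : G → ℝ}

omit [Group G] in
lemma IsProb.summable_sq (hf : IsProb f) : Summable fun x => f x ^ 2 :=
  Summable.of_nonneg_of_le (fun x => sq_nonneg _)
    (fun x => by nlinarith [hf.1 x, hf.le_one x]) hf.2.summable

/-- A probability measure viewed as an element of `ℓ²(G)`. -/
noncomputable def IsProb.toL2 (hf : IsProb f) : lp (fun _ : G => ℝ) 2 :=
  ⟨f, memℓp_gen (by simpa using hf.summable_sq)⟩

omit [Group G] in
lemma IsProb.toL2_apply (hf : IsProb f) (x : G) : hf.toL2 x = f x := rfl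

omit [Group G] in
lemma IsProb.norm_toL2_sq (hf : IsProb f) : ‖hf.toL2‖ ^ 2 = ∑' x, f x ^ 2 := by
  rw [← real_inner_self_eq_norm_sq, lp.inner_eq_tsum]
  exact tsum_congr fun x => by simp [hf.toL2_apply, sq]

omit [Group G] in
lemma IsProb.norm_toL2_pos (hf : IsProb f) : 0 < ‖hf.toL2‖ := by
  rw [norm_pos_iff]
  intro h
  have h0 : f = 0 := congrArg (fun u : lp (fun _ : G => ℝ) 2 => (u : G → ℝ)) h
  have := hf.2
  rw [h0] at this
  exact one_ne_zero (this.unique hasSum_zero)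

omit [Group G] in
lemma IsProb.norm_toL2_le_one (hf : IsProb f) : ‖hf.toL2‖ ≤ 1 := by
  rw [← abs_norm, ← sq_le_one_iff_abs_le_one, hf.norm_toL2_sq, ← hf.2.tsum_eq]
  exact hf.summable_sq.tsum_le_tsum (fun x => by nlinarith [hf.1 x, hf.le_one x]) hf.2.summable

lemma conv_self_le (hf : IsProb f) (x : G) : conv f f x ≤ ‖hf.toL2‖ ^ 2 := by
  have h1 : HasSum (fun h => f (x * h⁻¹) ^ 2) (‖hf.toL2‖ ^ 2) := by
    rw [hf.norm_toL2_sq]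
    have := (Equiv.divLeft x).hasSum_iff.2 hf.summable_sq.hasSum
    simpa [Function.comp_def, div_eq_mul_inv] using this
  have h2 : HasSum (fun h => f h ^ 2) (‖hf.toL2‖ ^ 2) := by
    rw [hf.norm_toL2_sq]; exact hf.summable_sq.hasSum
  have h3 := (h1.add h2).div_const 2
  rw [add_self_div_two] at h3
  exact hasSum_le (fun h => by nlinarith [sq_nonneg (f (x * h⁻¹) - f h)])
    (hf.summable_conv hf x).hasSum h3

lemma hasSum_smul_shift (hf : IsProb f) (hg : IsProb g) :
    HasSum (fun h => g h • shift h⁻¹ hf.toL2) (hf.conv hg).toL2 := by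
  have hs : Summable fun h => g h • shift h⁻¹ hf.toL2 := by
    refine Summable.of_norm_bounded (hg.2.summable.mul_right ‖hf.toL2‖) fun h => ?_
    rw [norm_smul, (shift h⁻¹).norm_map, Real.norm_of_nonneg (hg.1 h)]
  convert hs.hasSum
  ext x
  have := (lp.evalCLM ℝ (fun _ : G => ℝ) 2 x).map_tsum hs
  refine Eq.trans ?_ this.symm
  exact tsum_congr fun h => mul_comm _ _

/-- One convolution step contracts the `ℓ²` norm, with a gain controlled by the displacement
of `f` under the difference of two atoms. -/
lemma norm_conv_le (hf : IsProb f) (hg : IsProb g) {ε : ℝ} (hε : 0 < ε) {s t : G}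
    (hs : ε ≤ g s) (ht : ε ≤ g t) :
    ε * ‖shift s⁻¹ hf.toL2 - shift t⁻¹ hf.toL2‖ ^ 2 ≤
      4 * ‖hf.toL2‖ * (‖hf.toL2‖ - ‖(hf.conv hg).toL2‖) := by
  classical
  have hF := hf.norm_toL2_pos
  have hsum := hasSum_smul_shift hf hg
  set u := hf.toL2
  set v := (hf.conv hg).toL2
  rcases eq_or_ne s t with rfl | hst
  · have : ‖v‖ ≤ ‖u‖ := by
      have h := hg.2.mul_right ‖u‖
      rw [one_mul] at h
      refine hsum.norm_le_of_bounded h fun h => ?_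
      rw [norm_smul, (shift h⁻¹).norm_map, Real.norm_of_nonneg (hg.1 h)]
    simp only [sub_self, norm_zero]
    have : 0 ≤ 4 * ‖u‖ * (‖u‖ - ‖v‖) := mul_nonneg (by positivity) (by linarith)
    simpa using this
  set r : G → ℝ := fun h => g h - (if h = s then ε else 0) - (if h = t then ε else 0)
  have hr0 : ∀ h, 0 ≤ r h := by
    intro h
    simp only [r]
    split_ifs with h1 h2 h2
    · exact absurd (h1.symm.trans h2) hst
    · subst h1; linarith
    · subst h2; linarith
    · simpa using hg.1 h
  have hr : HasSum r (1 - ε - ε) :=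
    (hg.2.sub (hasSum_ite_eq s ε)).sub (hasSum_ite_eq t ε)
  have hrs : HasSum (fun h => r h • shift h⁻¹ u) (v - ε • shift s⁻¹ u - ε • shift t⁻¹ u) := by
    convert (hsum.sub (hasSum_ite_eq s (ε • shift s⁻¹ u))).sub
      (hasSum_ite_eq t (ε • shift t⁻¹ u)) using 2 with h
    simp only [r, sub_smul, ite_smul, zero_smul]
    congr 1
    · congr 1
      split_ifs with h1
      · rw [h1]
      · rfl
    · split_ifs with h1
      · rw [h1]
      · rfl
  have hbound : ‖v - ε • shift s⁻¹ u - ε • shift t⁻¹ u‖ ≤ (1 - ε - ε) * ‖u‖ := by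
    refine hrs.norm_le_of_bounded (hr.mul_right ‖u‖) fun h => ?_
    rw [norm_smul, (shift h⁻¹).norm_map, Real.norm_of_nonneg (hr0 h)]
  have hv : ‖v‖ ≤ ε * ‖shift s⁻¹ u + shift t⁻¹ u‖ + (1 - ε - ε) * ‖u‖ := by
    calc ‖v‖ = ‖ε • (shift s⁻¹ u + shift t⁻¹ u) + (v - ε • shift s⁻¹ u - ε • shift t⁻¹ u)‖ := by
          congr 1; rw [smul_add]; abel
      _ ≤ _ := (norm_add_le _ _).trans (by
          rw [norm_smul, Real.norm_of_nonneg hε.le]; gcongr)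
  have hpar := parallelogram_law_with_norm ℝ (shift s⁻¹ u) (shift t⁻¹ u)
  rw [(shift s⁻¹).norm_map, (shift t⁻¹).norm_map] at hpar
  set P := ‖shift s⁻¹ u + shift t⁻¹ u‖
  set D := ‖shift s⁻¹ u - shift t⁻¹ u‖
  have hP : D ^ 2 ≤ 4 * ‖u‖ * (2 * ‖u‖ - P) := by nlinarith [sq_nonneg (P - 2 * ‖u‖)]
  calc ε * D ^ 2 ≤ ε * (4 * ‖u‖ * (2 * ‖u‖ - P)) := by gcongr
    _ = 4 * ‖u‖ * (ε * (2 * ‖u‖ - P)) := by ring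
    _ ≤ 4 * ‖u‖ * (‖u‖ - ‖v‖) := by gcongr; linarith

lemma norm_shift_sub_le_of_mem_pow [DecidableEq G] {T : Finset G} {D : ℝ}
    (u : lp (fun _ : G => ℝ) 2) (hD : ∀ t ∈ T, ‖shift t u - u‖ ≤ D) (m : ℕ) :
    ∀ b ∈ T ^ m, ‖shift b u - u‖ ≤ m * D := by
  induction m with
  | zero =>
    intro b hb
    rw [pow_zero, Finset.mem_one] at hb
    simp [hb, shift_one]
  | succ m ih =>
    intro b hb
    rw [pow_succ] at hb
    obtain ⟨a, ha, t, ht, rfl⟩ := Finset.mem_mul.1 hb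
    calc ‖shift (a * t) u - u‖ = ‖shift a (shift t u - u) + (shift a u - u)‖ := by
          rw [shift_mul, map_sub]; congr 1; abel
      _ ≤ D + m * D := (norm_add_le _ _).trans <|
          add_le_add (((shift a).norm_map _).trans_le (hD t ht)) (ih a ha)
      _ = (m + 1 : ℕ) * D := by push_cast; ring

/-- A pseudo-Poincaré inequality: `f` is compared with its averages over the set `B`. -/
lemma card_mul_norm_sq_le (hf : IsProb f) (B : Finset G) {δ : ℝ}
    (hB : ∀ b ∈ B, ‖shift b hf.toL2 - hf.toL2‖ ≤ δ) :
    B.card * ‖hf.toL2‖ ^ 2 ≤ B.card * (‖hf.toL2‖ * δ) + 1 := by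
  set u := hf.toL2
  have h1 : ∀ b ∈ B, ‖u‖ ^ 2 ≤ ‖u‖ * δ + inner ℝ u (shift b u) := by
    intro b hb
    have : ‖u‖ ^ 2 = inner ℝ u (u - shift b u) + inner ℝ u (shift b u) := by
      rw [← inner_add_right, sub_add_cancel, real_inner_self_eq_norm_sq]
    rw [this]
    gcongr
    refine (real_inner_le_norm _ _).trans ?_
    gcongr
    rw [norm_sub_rev]
    exact hB b hb
  have h2 : ∑ b ∈ B, inner ℝ u (shift b u) ≤ 1 := by
    have hs : HasSum (fun x => ∑ b ∈ B, inner ℝ (u x) (shift b u x))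
        (∑ b ∈ B, inner ℝ u (shift b u)) :=
      hasSum_sum fun b _ => lp.hasSum_inner u (shift b u)
    refine hasSum_le (fun x => ?_) hs hf.2
    have h3 : ∑ b ∈ B, f (x * b) ≤ 1 :=
      sum_le_hasSum B (fun b _ => hf.1 _) ((Equiv.mulLeft x).hasSum_iff.2 hf.2)
    calc ∑ b ∈ B, inner ℝ (u x) (shift b u x) = f x * ∑ b ∈ B, f (x * b) := by
          rw [Finset.mul_sum]
          exact Finset.sum_congr rfl fun b _ => mul_comm _ _
      _ ≤ f x := mul_le_of_le_one_right (hf.1 x) h3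
  have h4 := Finset.sum_le_sum h1
  rw [Finset.sum_add_distrib, Finset.sum_const, Finset.sum_const, nsmul_eq_mul, nsmul_eq_mul] at h4
  linarith

end Hilbert

section Growth

open scoped Pointwise

lemma exists_mem_pow_of_mem_ballOf [DecidableEq G] {S : Finset G} {n : ℕ} {g : G}
    (hg : g ∈ ballOf (S : Set G) n) : ∃ k ≤ n, g ∈ S ^ k := by
  obtain ⟨l, rfl, hl, rfl⟩ := hg
  induction l with
  | nil => exact ⟨0, le_rfl, by simp⟩
  | cons x l ih =>
    obtain ⟨k, hk, hmem⟩ := ih fun y hy => hl y (List.mem_cons_of_mem _ hy)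
    rw [List.prod_cons, List.length_cons]
    rcases hl x List.mem_cons_self with rfl | hx
    · exact ⟨k, hk.trans (Nat.le_succ _), by rwa [one_mul]⟩
    · refine ⟨k + 1, Nat.succ_le_succ hk, ?_⟩
      rw [pow_succ']
      exact Finset.mul_mem_mul hx hmem

lemma ncard_ballOf_le [DecidableEq G] {S : Finset G} (hS : S.Nonempty)
    (hsymm : ∀ s ∈ S, s⁻¹ ∈ S) (n : ℕ) :
    (ballOf (S : Set G) n).ncard ≤ 2 * ((S ^ 2) ^ n).card := by
  obtain ⟨s, hs⟩ := hS
  have h1 : (1 : G) ∈ S ^ 2 := by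
    rw [sq]
    exact Finset.mem_mul.2 ⟨s, hs, s⁻¹, hsymm s hs, mul_inv_cancel s⟩
  have hsub : ballOf (S : Set G) n ⊆
      ((((S ^ 2) ^ n ∪ ((S ^ 2) ^ n).image (· * s⁻¹) : Finset G)) : Set G) := by
    intro g hg
    obtain ⟨k, hk, hmem⟩ := exists_mem_pow_of_mem_ballOf hg
    rw [Finset.coe_union]
    obtain ⟨j, rfl | rfl⟩ := Nat.even_or_odd' k
    · rw [pow_mul] at hmem
      exact .inl (Finset.pow_subset_pow_right h1 (by omega) hmem)
    · refine .inr (Finset.mem_coe.2 (Finset.mem_image.2 ⟨g * s, ?_, by simp⟩))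
      have : g * s ∈ (S ^ 2) ^ (j + 1) := by
        rw [← pow_mul, show 2 * (j + 1) = 2 * j + 1 + 1 by ring, pow_succ]
        exact Finset.mul_mem_mul hmem hs
      exact Finset.pow_subset_pow_right h1 (by omega) this
  calc (ballOf (S : Set G) n).ncard
      ≤ ((S ^ 2) ^ n ∪ ((S ^ 2) ^ n).image (· * s⁻¹)).card := by
        rw [← Set.ncard_coe_finset]
        exact Set.ncard_le_ncard hsub (Finset.finite_toSet _)
    _ ≤ ((S ^ 2) ^ n).card + (((S ^ 2) ^ n).image (· * s⁻¹)).card := Finset.card_union_le _ _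
    _ ≤ 2 * ((S ^ 2) ^ n).card := by
        rw [two_mul]
        exact Nat.add_le_add_left Finset.card_image_le _

end Growth

section Recursion

lemma add_mul_le_rpow_neg_of_recursion {F : ℕ → ℝ} {β κ : ℝ} (hβ : 0 < β) (hpos : ∀ n, 0 < F n)
    (h0 : F 0 ≤ 1) (hrec : ∀ n, F (n + 1) ≤ F n * (1 - κ * F n ^ β)) (n : ℕ) :
    1 + β * κ * n ≤ F n ^ (-β) := by
  induction n with
  | zero => simpa using Real.one_le_rpow_of_pos_of_le_one_of_nonpos (hpos 0) h0 (by linarith)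
  | succ n ih =>
    set x := κ * F n ^ β
    have h1 : F (n + 1) ≤ F n * Real.exp (-x) :=
      (hrec n).trans (mul_le_mul_of_nonneg_left (Real.one_sub_le_exp_neg x) (hpos n).le)
    have h2 : F n ^ (-β) * F n ^ β = 1 := by
      rw [← Real.rpow_add (hpos n), neg_add_cancel, Real.rpow_zero]
    calc 1 + β * κ * (n + 1 : ℕ) = (1 + β * κ * n) + β * κ := by push_cast; ring
      _ ≤ F n ^ (-β) + β * κ := by gcongr
      _ = F n ^ (-β) * (β * x + 1) := by linear_combination (-(β * κ)) * h2
      _ ≤ F n ^ (-β) * Real.exp (β * x) := by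
        have := Real.rpow_nonneg (hpos n).le (-β)
        gcongr
        exact Real.add_one_le_exp _
      _ = (F n * Real.exp (-x)) ^ (-β) := by
        rw [Real.mul_rpow (hpos n).le (Real.exp_pos _).le, ← Real.exp_mul]
        congr 2
        ring
      _ ≤ F (n + 1) ^ (-β) := Real.rpow_le_rpow_of_nonpos (hpos _) h1 (by linarith)

/-- The Nash-type inequality obtained by optimizing the pseudo-Poincaré inequality over the
radius, when the volume growth is at least of order `d`. -/
lemma le_mul_one_sub_of_pseudoPoincare {F V D ε c d : ℝ} {b : ℕ → ℝ} (hF : 0 < F) (hF1 : F ≤ 1)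
    (hD : 0 ≤ D) (hε : 0 < ε) (hc : 0 < c) (hc2 : c ≤ 2) (hd : 0 < d)
    (hb : ∀ m : ℕ, 1 ≤ m → c * (m : ℝ) ^ d ≤ b m)
    (hP : ∀ m : ℕ, b m * F ^ 2 ≤ b m * (F * (m * D)) + 1)
    (hgap : ε * D ^ 2 ≤ 4 * F * (F - V)) :
    V ≤ F * (1 - ε / 64 * (c / 2) ^ (2 / d) * F ^ (4 / d)) := by
  set z := 2 / (c * F ^ 2) with hz
  have hz1 : 1 ≤ z := by
    rw [hz, one_le_div (by positivity)]
    nlinarith [mul_le_mul_of_nonneg_left (pow_le_one₀ hF.le hF1 : F ^ 2 ≤ 1) hc.le]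
  have hz0 : 0 < z := by linarith
  set y := z ^ (1 / d)
  have hy1 : 1 ≤ y := Real.one_le_rpow hz1 (by positivity)
  have hy0 : 0 < y := by linarith
  set m := ⌈y⌉₊
  have hym : y ≤ m := Nat.le_ceil y
  have hm2 : (m : ℝ) ≤ 2 * y := by linarith [Nat.ceil_lt_add_one hy0.le]
  have hm1 : 1 ≤ m := by exact_mod_cast hy1.trans hym
  have hbm : 2 ≤ b m * F ^ 2 := by
    have : z ≤ (m : ℝ) ^ d := by
      calc z = y ^ d := by rw [← Real.rpow_mul hz0.le, one_div_mul_cancel hd.ne', Real.rpow_one]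
        _ ≤ (m : ℝ) ^ d := by gcongr
    calc (2 : ℝ) = c * z * F ^ 2 := by rw [hz]; field_simp
      _ ≤ c * (m : ℝ) ^ d * F ^ 2 := by gcongr
      _ ≤ b m * F ^ 2 := by gcongr; exact hb m hm1
  have hb0 : 0 < b m := by
    by_contra! h
    nlinarith [mul_nonpos_of_nonpos_of_nonneg h (sq_nonneg F)]
  have h1 : F ≤ 2 * (m * D) := by
    have : b m * F * F ≤ b m * F * (2 * (m * D)) := by nlinarith [hP m]
    exact le_of_mul_le_mul_left this (by positivity)
  have h2 : F ≤ 4 * y * D := by nlinarith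
  have h3 : F ^ 2 ≤ 16 * y ^ 2 * D ^ 2 := by
    calc F ^ 2 ≤ (4 * y * D) ^ 2 := by gcongr
      _ = _ := by ring
  have hyinv : (c / 2) ^ (2 / d) * F ^ (4 / d) * y ^ 2 = 1 := by
    have e1 : F ^ (4 / d) = (F ^ 2) ^ (2 / d) := by
      rw [← Real.rpow_natCast F 2, ← Real.rpow_mul hF.le]
      congr 1; push_cast; ring
    have e2 : y ^ 2 = z ^ (2 / d) := by
      rw [← Real.rpow_natCast y 2, ← Real.rpow_mul hz0.le]
      congr 1; push_cast; ring
    rw [e1, e2, ← Real.mul_rpow (by positivity) (by positivity),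
      ← Real.mul_rpow (by positivity) hz0.le]
    have : c / 2 * F ^ 2 * z = 1 := by rw [hz]; field_simp
    rw [this, Real.one_rpow]
  set w := (c / 2) ^ (2 / d) * F ^ (4 / d)
  have hw : 0 < w := by positivity
  have h4 : ε * F ^ 2 ≤ 16 * y ^ 2 * (4 * F * (F - V)) := by
    calc ε * F ^ 2 ≤ ε * (16 * y ^ 2 * D ^ 2) := by gcongr
      _ = 16 * y ^ 2 * (ε * D ^ 2) := by ring
      _ ≤ _ := by gcongr
  have h5 : F * (ε / 64 * w * F) ≤ F * (F - V) := by
    calc F * (ε / 64 * w * F) = w / 64 * (ε * F ^ 2) := by ring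
      _ ≤ w / 64 * (16 * y ^ 2 * (4 * F * (F - V))) := by gcongr
      _ = (w * y ^ 2) * (F * (F - V)) := by ring
      _ = F * (F - V) := by rw [hyinv, one_mul]
  have h6 := le_of_mul_le_mul_left h5 hF
  calc V ≤ F - ε / 64 * w * F := by linarith
    _ = _ := by simp only [w]; ring

end Recursion

section Decay

open scoped Pointwise

/-- On-diagonal decay of the `ℓ²` norms along multiples of `N`, with constants depending on the
measure only through the lower bound `ε` for its `N`-th convolution power on `S`. -/
lemma one_add_mul_le_norm_convPow_rpow [DecidableEq G] {S : Finset G} (hS : S.Nonempty)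
    (hsymm : ∀ s ∈ S, s⁻¹ ∈ S) {c d ε : ℝ} (hc : 0 < c) (hc2 : c ≤ 2) (hd : 0 < d) (hε : 0 < ε)
    (hgrowth : ∀ m : ℕ, 1 ≤ m → c * (m : ℝ) ^ d ≤ ((S ^ 2) ^ m).card)
    {ν : G → ℝ} (hν : IsProb ν) {N : ℕ} (hS_le : ∀ s ∈ S, ε ≤ convPow ν N s) (q : ℕ) :
    1 + 4 / d * (ε / 64 * (c / 2) ^ (2 / d)) * q ≤
      ‖(hν.convPow (q * N)).toL2‖ ^ (-(4 / d)) := by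
  refine add_mul_le_rpow_neg_of_recursion (F := fun q => ‖(hν.convPow (q * N)).toL2‖)
    (by positivity) (fun q => (hν.convPow _).norm_toL2_pos)
    (hν.convPow _).norm_toL2_le_one (fun q => ?_) q
  set hf := hν.convPow (q * N)
  have hstep : ‖(hν.convPow ((q + 1) * N)).toL2‖ = ‖(hf.conv (hν.convPow N)).toL2‖ := by
    congr 2
    ext x
    simp only [Nat.succ_mul, convPow_add hν]
  simp only [hstep]
  set F := ‖hf.toL2‖
  set V := ‖(hf.conv (hν.convPow N)).toL2‖
  have hle : ∀ s ∈ S, ∀ t ∈ S,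
      ε * ‖shift s⁻¹ hf.toL2 - shift t⁻¹ hf.toL2‖ ^ 2 ≤ 4 * F * (F - V) := fun s hs t ht =>
    norm_conv_le hf (hν.convPow N) hε (hS_le s hs) (hS_le t ht)
  have hnonneg : 0 ≤ 4 * F * (F - V) := by
    obtain ⟨s, hs⟩ := hS
    exact le_trans (by positivity) (hle s hs s hs)
  set D := √(4 * F * (F - V) / ε)
  have hD : ∀ t ∈ S ^ 2, ‖shift t hf.toL2 - hf.toL2‖ ≤ D := by
    intro g hg
    rw [sq] at hg
    obtain ⟨s, hs, t, ht, rfl⟩ := Finset.mem_mul.1 hg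
    have h := hle t⁻¹ (hsymm t ht) s hs
    rw [inv_inv, ← (shift s).norm_map, map_sub, ← shift_mul, ← shift_mul, mul_inv_cancel,
      shift_one] at h
    refine Real.le_sqrt_of_sq_le ?_
    rwa [le_div_iff₀' hε]
  refine le_mul_one_sub_of_pseudoPoincare (b := fun m => (((S ^ 2) ^ m).card : ℝ))
    hf.norm_toL2_pos hf.norm_toL2_le_one (Real.sqrt_nonneg _) hε hc hc2 hd hgrowth
    (fun m => card_mul_norm_sq_le hf _ (norm_shift_sub_le_of_mem_pow _ hD m)) ?_
  rw [Real.sq_sqrt (by positivity), mul_div_cancel₀ _ hε.ne']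

/-- Heat kernel decay with a constant depending only on `S`, `N` and the lower bound `ε`. -/
theorem exists_convPow_le_of_growth {S : Finset G} (hsymm : ∀ s ∈ S, s⁻¹ ∈ S) {c d ε : ℝ}
    (hc : 0 < c) (hd : 0 < d) (hε : 0 < ε)
    (hgrowth : ∀ n : ℕ, 1 ≤ n → c * (n : ℝ) ^ d ≤ ((ballOf (S : Set G) n).ncard : ℝ))
    {N : ℕ} (hN : 1 ≤ N) :
    ∃ C : ℝ, 0 < C ∧ ∀ ν : G → ℝ, IsProb ν → (∀ s ∈ S, ε ≤ convPow ν N s) →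
      ∀ n : ℕ, 1 ≤ n → ∀ x, convPow ν n x ≤ C * (n : ℝ) ^ (-(d / 2)) := by
  classical
  have hS : S.Nonempty := by
    rw [Finset.nonempty_iff_ne_empty]
    rintro rfl
    have hball : ∀ n, ballOf ((∅ : Finset G) : Set G) n ⊆ {1} := by
      rintro n g ⟨l, -, hl, rfl⟩
      exact List.prod_eq_one fun x hx => by simpa using hl x hx
    have hbdd : ∀ n : ℕ, 1 ≤ n → (n : ℝ) ^ d ≤ 1 / c := by
      intro n hn
      rw [le_div_iff₀' hc]
      refine (hgrowth n hn).trans ?_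
      exact_mod_cast (Set.ncard_le_ncard (hball n)).trans (Set.ncard_singleton 1).le
    have htend : Tendsto (fun n : ℕ => (n : ℝ) ^ d) atTop atTop :=
      (tendsto_rpow_atTop hd).comp tendsto_natCast_atTop_atTop
    obtain ⟨n, h1, h2⟩ := ((htend.eventually_gt_atTop (1 / c)).and (eventually_ge_atTop 1)).exists
    exact (hbdd n h2).not_gt h1
  set c' := min (c / 2) 2
  have hc' : 0 < c' := lt_min (by positivity) two_pos
  have hgrowth' : ∀ m : ℕ, 1 ≤ m → c' * (m : ℝ) ^ d ≤ ((S ^ 2) ^ m).card := by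
    intro m hm
    have h1 : ((ballOf (S : Set G) m).ncard : ℝ) ≤ 2 * ((S ^ 2) ^ m).card := by
      exact_mod_cast ncard_ballOf_le hS hsymm m
    calc c' * (m : ℝ) ^ d ≤ c / 2 * (m : ℝ) ^ d := by gcongr; exact min_le_left _ _
      _ ≤ ((S ^ 2) ^ m).card := by linarith [hgrowth m hm]
  set a := 4 / d * (ε / 64 * (c' / 2) ^ (2 / d))
  have ha : 0 < a := by positivity
  set b := min 1 a
  have hb : 0 < b := lt_min one_pos ha
  have hN0 : (0 : ℝ) < N := by exact_mod_cast hN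
  refine ⟨(b / (2 * N)) ^ (-(d / 2)), by positivity, fun ν hν hνS n hn x => ?_⟩
  set q := n / (2 * N)
  set hf := hν.convPow (q * N)
  have hn0 : (0 : ℝ) < n := by exact_mod_cast hn
  have hsplit : n = q * N + q * N + n % (2 * N) := by
    rw [← two_mul, ← mul_assoc, mul_comm 2 q, mul_assoc, Nat.div_add_mod' n (2 * N)]
  have hnq : (n : ℝ) ≤ 2 * N * (q + 1) := by
    exact_mod_cast (Nat.lt_mul_div_succ n (Nat.mul_pos two_pos hN)).le
  have hnorm := one_add_mul_le_norm_convPow_rpow hS hsymm hc' (min_le_right _ _) hd hε hgrowth'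
    hν hνS q
  have hlow : b / (2 * N) * n ≤ ‖hf.toL2‖ ^ (-(4 / d)) := by
    calc b / (2 * N) * n ≤ b / (2 * N) * (2 * N * (q + 1)) := by gcongr
      _ = b * 1 + b * q := by field_simp; ring
      _ ≤ 1 * 1 + a * q := by gcongr; exacts [min_le_left _ _, min_le_right _ _]
      _ ≤ _ := by rwa [mul_one]
  calc convPow ν n x ≤ ‖hf.toL2‖ ^ 2 := by
        rw [hsplit, convPow_add hν]
        refine conv_le_of_le (hν.convPow _) (hν.convPow _) (fun y => ?_) x
        rw [convPow_add hν]
        exact conv_self_le hf y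
    _ = (‖hf.toL2‖ ^ (-(4 / d))) ^ (-(d / 2)) := by
        rw [← Real.rpow_mul (norm_nonneg _), ← Real.rpow_natCast]
        congr 1
        field_simp
        norm_num
    _ ≤ (b / (2 * N) * n) ^ (-(d / 2)) :=
        Real.rpow_le_rpow_of_nonpos (by positivity) hlow (by linarith)
    _ = _ := Real.mul_rpow (by positivity) hn0.le

end Decay

theorem uniform_heatKernel_decay
    {G : Type*} [Group G] [Countable G]
    (μ : G → ℝ) (hμ : IsProb μ)
    (N : ℕ) (hN : 1 ≤ N) (d : ℝ) (hd : 1 ≤ d)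
    (hgrowth : GrowthAtLeastWithin (Function.support (convPow μ N)) d)
    (μk : ℕ → G → ℝ) (hμk : ∀ k, IsProb (μk k))
    (hpt : ∀ g : G, Tendsto (fun k => μk k g) atTop (nhds (μ g))) :
    ∃ C : ℝ, 0 < C ∧ ∃ K : ℕ, 1 ≤ K ∧ ∀ n : ℕ, 1 ≤ n →
      (∀ k, K ≤ k → ∀ x y : G, convPow (μk k) n (x⁻¹ * y) ≤ C * (n : ℝ) ^ (-(d / 2))) ∧
      (∀ x y : G, convPow μ n (x⁻¹ * y) ≤ C * (n : ℝ) ^ (-(d / 2))) := by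
  obtain ⟨S, hS, hsymm, c, hc, hgr⟩ := hgrowth
  have key : ∀ fk : ℕ → G → ℝ, (∀ k, IsProb (fk k)) →
      (∀ g, Tendsto (fun k => fk k g) atTop (nhds (μ g))) →
      ∀ᶠ ε : ℝ in nhdsWithin 0 (Set.Ioi 0), ∀ᶠ k in atTop, ∀ s ∈ S, ε ≤ convPow (fk k) N s := by
    intro fk hfk hlim
    have : ∀ s ∈ S, ∀ᶠ ε : ℝ in nhdsWithin 0 (Set.Ioi 0), ∀ᶠ k in atTop,
        ε ≤ convPow (fk k) N s := by
      intro s hs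
      obtain ⟨δ, hδ, hev⟩ := eventually_le_convPow hμ hfk hlim N (hS hs)
      filter_upwards [Ioc_mem_nhdsGT hδ] with ε hε
      exact hev.mono fun k hk => hε.2.trans hk
    filter_upwards [(Finset.eventually_all S).2 this] with ε hε
    exact (Finset.eventually_all S).2 hε
  obtain ⟨ε, hε, hεk, hεμ⟩ := ((eventually_mem_nhdsWithin (a := (0 : ℝ))
    (s := Set.Ioi 0)).and ((key μk hμk hpt).and
      (key (fun _ => μ) (fun _ => hμ) fun _ => tendsto_const_nhds))).exists
  obtain ⟨C, hC, hbound⟩ := exists_convPow_le_of_growth hsymm hc (by linarith) hε hgr hN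
  obtain ⟨K, hK⟩ := eventually_atTop.1 hεk
  refine ⟨C, hC, max K 1, le_max_right _ _, fun n hn => ⟨fun k hk x y => ?_, fun x y => ?_⟩⟩
  · exact hbound (μk k) (hμk k) (hK k ((le_max_left _ _).trans hk)) n hn _
  · exact hbound μ hμ hεμ.exists.choose_spec n hn _

end RW
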